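/- Let 𝕜 be ℝ or ℂ, let k ≥ 2 be an integer, and let C > 0. If g[CP_n(𝕜)] ≥ C·n for every n ∈ {k, k+1, …, 2k−1}, then g[CP_n(𝕜)] ≥ ((1/k; 1/2)_∞ / (1 − 1/k)) · C·n for every n ≥ k. -/

import Mathlib

open scoped BigOperators

/-- `geIter A k` is the Gaussian elimination iterate `A^{(k+1)}` (0-indexed, `geIter A 0 = A`).
Entries with row or column index `< k` are left unchanged; they are irrelevant. -/
noncomputable def geIter {𝕜 : Type*} [Field 𝕜] {n : ℕ} (A : Matrix (Fin n) (Fin n) 𝕜) :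
    ℕ → Matrix (Fin n) (Fin n) 𝕜
  | 0 => A
  | k + 1 => fun i j =>
    if h : k < n ∧ k + 1 ≤ i.1 ∧ k + 1 ≤ j.1 then
      geIter A k i j -
        geIter A k i ⟨k, h.1⟩ * geIter A k ⟨k, h.1⟩ j / geIter A k ⟨k, h.1⟩ ⟨k, h.1⟩
    else geIter A k i j

/-- The norm of the pivot `a^{(k+1)}_{k,k}` (0-indexed). -/
noncomputable def pivotNorm {𝕜 : Type*} [RCLike 𝕜] {n : ℕ}
    (A : Matrix (Fin n) (Fin n) 𝕜) (k : ℕ) : ℝ :=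
  if h : k < n then ‖geIter A k ⟨k, h⟩ ⟨k, h⟩‖ else 0

/-- The growth factor `g(A)`. -/
noncomputable def growth {𝕜 : Type*} [RCLike 𝕜] {n : ℕ} (A : Matrix (Fin n) (Fin n) 𝕜) : ℝ :=
  (⨆ k : Fin n, ⨆ i : Fin n, ⨆ j : Fin n,
      if k.1 ≤ i.1 ∧ k.1 ≤ j.1 then ‖geIter A k.1 i j‖ else 0) /
    ⨆ i : Fin n, ⨆ j : Fin n, ‖A i j‖

/-- `A` is completely pivoted: `A ∈ CP_n(𝕜)`. -/
def IsCP {𝕜 : Type*} [RCLike 𝕜] {n : ℕ} (A : Matrix (Fin n) (Fin n) 𝕜) : Prop :=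
  A.det ≠ 0 ∧ (∀ k : ℕ, k + 1 < n → pivotNorm A k ≠ 0) ∧
    ∀ (k : ℕ) (i j : Fin n), k ≤ i.1 → k ≤ j.1 → ‖geIter A k i j‖ ≤ pivotNorm A k

/-- `g[CP_n(𝕜)]`. -/
noncomputable def gCP (𝕜 : Type*) [RCLike 𝕜] (n : ℕ) : ℝ :=
  sSup (growth '' {A : Matrix (Fin n) (Fin n) 𝕜 | IsCP A})

/-- The infinite q-Pochhammer symbol `(a;q)_∞`. -/
noncomputable def qPochInf (a q : ℝ) : ℝ := ∏' i : ℕ, (1 - a * q ^ i)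


section Aux

variable {𝕜 : Type*} [RCLike 𝕜]

lemma geIter_succ_of {n : ℕ} (A : Matrix (Fin n) (Fin n) 𝕜) (k : ℕ) (hk : k < n) (i j : Fin n)
    (hi : k + 1 ≤ i.1) (hj : k + 1 ≤ j.1) :
    geIter A (k + 1) i j = geIter A k i j -
        geIter A k i ⟨k, hk⟩ * geIter A k ⟨k, hk⟩ j / geIter A k ⟨k, hk⟩ ⟨k, hk⟩ := by
  simp only [geIter]
  rw [dif_pos ⟨hk, hi, hj⟩]

lemma pivotNorm_of {n : ℕ} (A : Matrix (Fin n) (Fin n) 𝕜) (k : ℕ) (hk : k < n) :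
    pivotNorm A k = ‖geIter A k ⟨k, hk⟩ ⟨k, hk⟩‖ := by
  simp [pivotNorm, hk]

lemma pivotNorm_nonneg {n : ℕ} (A : Matrix (Fin n) (Fin n) 𝕜) (k : ℕ) : 0 ≤ pivotNorm A k := by
  unfold pivotNorm
  split_ifs <;> positivity

/-- Rows of the iterates are row combinations of the original matrix. -/
lemma exists_row {n : ℕ} (A : Matrix (Fin n) (Fin n) 𝕜)
    (hp : ∀ k : ℕ, k + 1 < n → pivotNorm A k ≠ 0) (k : ℕ) :
    ∀ i : Fin n, k ≤ i.1 → ∃ v : Fin n → 𝕜, v i = 1 ∧ (∀ j : Fin n, k ≤ j.1 → j ≠ i → v j = 0) ∧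
      (∀ j : Fin n, j.1 < k → Matrix.vecMul v A j = 0) ∧
      (∀ j : Fin n, k ≤ j.1 → Matrix.vecMul v A j = geIter A k i j) := by
  induction k with
  | zero =>
    intro i _
    refine ⟨Pi.single i 1, by simp, fun j _ hj => by simp [hj], fun j hj => by omega, ?_⟩
    intro j _
    simp [geIter]
  | succ k ih =>
    intro i hi
    have hkn : k < n := by omega
    obtain ⟨v, v1, v2, v3, v4⟩ := ih i (by omega)
    obtain ⟨w, w1, w2, w3, w4⟩ := ih ⟨k, hkn⟩ le_rfl
    have hne : geIter A k ⟨k, hkn⟩ ⟨k, hkn⟩ ≠ 0 := by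
      have := hp k (by omega)
      rw [pivotNorm_of A k hkn] at this
      simpa using this
    refine ⟨v - (geIter A k i ⟨k, hkn⟩ / geIter A k ⟨k, hkn⟩ ⟨k, hkn⟩) • w, ?_, ?_, ?_, ?_⟩
    · have : w i = 0 := w2 i (by omega) (by intro h; rw [h] at hi; simp at hi)
      simp [v1, this]
    · intro j hj hji
      have h1 : w j = 0 := w2 j (by omega) (by intro h; rw [h] at hj; simp at hj)
      have h2 : v j = 0 := v2 j (by omega) hji
      simp [h1, h2]
    · intro j hj
      rw [Matrix.sub_vecMul, Matrix.smul_vecMul]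
      simp only [Pi.sub_apply, Pi.smul_apply, smul_eq_mul]
      rcases Nat.lt_succ_iff_lt_or_eq.mp hj with h | h
      · rw [v3 j h, w3 j h]; simp
      · have : j = ⟨k, hkn⟩ := Fin.ext h
        subst this
        rw [v4 _ le_rfl, w4 _ le_rfl]
        field_simp
        simp
    · intro j hj
      rw [Matrix.sub_vecMul, Matrix.smul_vecMul]
      simp only [Pi.sub_apply, Pi.smul_apply, smul_eq_mul]
      rw [v4 j (by omega), w4 j (by omega), geIter_succ_of A k hkn i j hi hj]
      ring

lemma IsCP.pivot_ne {n : ℕ} {A : Matrix (Fin n) (Fin n) 𝕜} (hA : IsCP A) (k : ℕ) (hk : k < n) :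
    geIter A k ⟨k, hk⟩ ⟨k, hk⟩ ≠ 0 := by
  by_cases h : k + 1 < n
  · have := hA.2.1 k h
    rw [pivotNorm_of A k hk] at this
    simpa using this
  · intro h0
    obtain ⟨v, v1, v2, v3, v4⟩ := exists_row A hA.2.1 k ⟨k, hk⟩ le_rfl
    apply hA.1
    rw [← Matrix.exists_vecMul_eq_zero_iff]
    refine ⟨v, fun hv => by simp [hv] at v1, ?_⟩
    funext j
    by_cases hj : j.1 < k
    · simpa using v3 j hj
    · have : j = ⟨k, hk⟩ := Fin.ext (by have := j.2; simp; omega)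
      subst this
      rw [v4 _ le_rfl, h0]; rfl

lemma IsCP.pivot_pos {n : ℕ} {A : Matrix (Fin n) (Fin n) 𝕜} (hA : IsCP A) (k : ℕ) (hk : k < n) :
    0 < pivotNorm A k := by
  rw [pivotNorm_of A k hk]
  exact norm_pos_iff.mpr (hA.pivot_ne k hk)

lemma denom_eq {n : ℕ} (hn : 0 < n) {A : Matrix (Fin n) (Fin n) 𝕜} (hA : IsCP A) :
    (⨆ i : Fin n, ⨆ j : Fin n, ‖A i j‖) = pivotNorm A 0 := by
  haveI : Nonempty (Fin n) := ⟨⟨0, hn⟩⟩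
  apply le_antisymm
  · exact ciSup_le fun i => ciSup_le fun j => hA.2.2 0 i j (Nat.zero_le _) (Nat.zero_le _)
  · rw [pivotNorm_of A 0 hn]
    refine le_trans ?_ (le_ciSup (Set.finite_range _).bddAbove (⟨0, hn⟩ : Fin n))
    exact le_ciSup (f := fun j => ‖A ⟨0, hn⟩ j‖) (Set.finite_range _).bddAbove (⟨0, hn⟩ : Fin n)

lemma growth_le {n : ℕ} (hn : 0 < n) {A : Matrix (Fin n) (Fin n) 𝕜} (hA : IsCP A) (c : ℝ)
    (h : ∀ k < n, pivotNorm A k ≤ c * pivotNorm A 0) : growth A ≤ c := by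
  haveI : Nonempty (Fin n) := ⟨⟨0, hn⟩⟩
  unfold growth
  rw [denom_eq hn hA, div_le_iff₀ (hA.pivot_pos 0 hn)]
  refine ciSup_le fun k => ciSup_le fun i => ciSup_le fun j => ?_
  split_ifs with hij
  · exact (hA.2.2 k i j hij.1 hij.2).trans (h k k.2)
  · exact (pivotNorm_nonneg A k).trans (h k k.2)

lemma le_growth {n : ℕ} (hn : 0 < n) {A : Matrix (Fin n) (Fin n) 𝕜} (hA : IsCP A) (k : ℕ)
    (hk : k < n) : pivotNorm A k ≤ growth A * pivotNorm A 0 := by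
  unfold growth
  rw [denom_eq hn hA, div_mul_cancel₀ _ (hA.pivot_pos 0 hn).ne']
  refine le_trans ?_ (le_ciSup (Set.finite_range _).bddAbove (⟨k, hk⟩ : Fin n))
  refine le_trans ?_ (le_ciSup (Set.finite_range _).bddAbove (⟨k, hk⟩ : Fin n))
  refine le_trans ?_ (le_ciSup (Set.finite_range _).bddAbove (⟨k, hk⟩ : Fin n))
  simp [pivotNorm_of A k hk]

lemma growth_nonneg {n : ℕ} (A : Matrix (Fin n) (Fin n) 𝕜) : 0 ≤ growth A := by
  unfold growth
  apply div_nonneg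
  · refine Real.iSup_nonneg fun k => Real.iSup_nonneg fun i => Real.iSup_nonneg fun j => ?_
    split_ifs <;> positivity
  · exact Real.iSup_nonneg fun i => Real.iSup_nonneg fun j => norm_nonneg _

lemma gCP_nonneg (n : ℕ) : 0 ≤ gCP 𝕜 n := by
  apply Real.sSup_nonneg
  rintro _ ⟨A, _, rfl⟩
  exact growth_nonneg A

lemma norm_quot_le (a x y p : 𝕜) (hp : p ≠ 0) (ha : ‖a‖ ≤ ‖p‖) (hx : ‖x‖ ≤ ‖p‖)
    (hy : ‖y‖ ≤ ‖p‖) : ‖a - x * y / p‖ ≤ 2 * ‖p‖ ∧ ‖a + x * y / p‖ ≤ 2 * ‖p‖ := by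
  have hpp : 0 < ‖p‖ := norm_pos_iff.mpr hp
  have h : ‖x * y / p‖ ≤ ‖p‖ := by
    rw [norm_div, norm_mul, div_le_iff₀ hpp]
    exact mul_le_mul hx hy (norm_nonneg _) hpp.le
  constructor
  · linarith [norm_sub_le a (x * y / p)]
  · linarith [norm_add_le a (x * y / p)]

lemma pivot_bound {n : ℕ} (hn : 0 < n) {A : Matrix (Fin n) (Fin n) 𝕜} (hA : IsCP A) (k : ℕ)
    (hk : k < n) : pivotNorm A k ≤ 2 ^ k * pivotNorm A 0 := by
  induction k with
  | zero => simp
  | succ k ih =>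
    have hk' : k < n := by omega
    have h1 := ih hk'
    have h2 : pivotNorm A (k + 1) ≤ 2 * pivotNorm A k := by
      rw [pivotNorm_of A _ hk, geIter_succ_of A k hk' _ _ le_rfl le_rfl]
      have hp := pivotNorm_of A k hk'
      rw [hp]
      refine (norm_quot_le _ _ _ _ (hA.pivot_ne k hk') ?_ ?_ ?_).1 <;> rw [← hp] <;>
        apply hA.2.2 <;> simp
    rw [pow_succ]
    linarith

lemma bdd (n : ℕ) (hn : 0 < n) :
    BddAbove (growth '' {A : Matrix (Fin n) (Fin n) 𝕜 | IsCP A}) := by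
  refine ⟨2 ^ n, ?_⟩
  rintro _ ⟨A, hA, rfl⟩
  apply growth_le hn hA
  intro k hk
  refine (pivot_bound hn hA k hk).trans ?_
  apply mul_le_mul_of_nonneg_right _ (pivotNorm_nonneg A 0)
  exact pow_le_pow_right₀ (by norm_num) hk.le

lemma gCP_step (c : ℝ) (hc : 0 ≤ c) (n m : ℕ) (hm : 0 < m)
    (h : ∀ A : Matrix (Fin n) (Fin n) 𝕜, IsCP A →
      ∃ B : Matrix (Fin m) (Fin m) 𝕜, IsCP B ∧ c * growth A ≤ growth B) :
    c * gCP 𝕜 n ≤ gCP 𝕜 m := by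
  rcases hc.eq_or_lt with rfl | hc
  · simpa using gCP_nonneg m
  rw [mul_comm, ← le_div_iff₀ hc]
  apply Real.sSup_le
  · rintro _ ⟨A, hA, rfl⟩
    obtain ⟨B, hB, hAB⟩ := h A hA
    rw [le_div_iff₀ hc, mul_comm]
    exact hAB.trans (le_csSup (bdd m hm) ⟨B, hB, rfl⟩)
  · exact div_nonneg (gCP_nonneg m) hc.le

/-! Padding -/

/-- `diag(A 0 0, A)`. -/
def padM {n : ℕ} (hn : 0 < n) (A : Matrix (Fin n) (Fin n) 𝕜) :
    Matrix (Fin (n + 1)) (Fin (n + 1)) 𝕜 :=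
  fun i j => Fin.cases (Fin.cases (A ⟨0, hn⟩ ⟨0, hn⟩) (fun _ => 0) j)
    (fun i' => Fin.cases 0 (fun j' => A i' j') j) i

lemma geIter_padM {n : ℕ} (hn : 0 < n) (A : Matrix (Fin n) (Fin n) 𝕜) (k : ℕ) :
    ∀ i j : Fin n, k ≤ i.1 → k ≤ j.1 →
      geIter (padM hn A) (k + 1) i.succ j.succ = geIter A k i j := by
  induction k with
  | zero =>
    intro i j _ _
    rw [geIter_succ_of _ 0 (by omega) _ _ (by simp) (by simp)]
    have h0 : (⟨0, by omega⟩ : Fin (n + 1)) = 0 := rfl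
    simp [geIter, padM, h0]
  | succ k ih =>
    intro i j hi hj
    have hk : k < n := by omega
    rw [geIter_succ_of _ (k + 1) (by omega) _ _ (by simpa using hi) (by simpa using hj),
      geIter_succ_of A k hk i j hi hj]
    have h0 : (⟨k + 1, by omega⟩ : Fin (n + 1)) = Fin.succ ⟨k, hk⟩ := rfl
    rw [h0, ih _ _ (by omega) (by omega), ih _ _ (by omega) le_rfl, ih _ _ le_rfl (by omega),
      ih _ _ le_rfl le_rfl]

lemma pivotNorm_padM_zero {n : ℕ} (hn : 0 < n) (A : Matrix (Fin n) (Fin n) 𝕜) :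
    pivotNorm (padM hn A) 0 = pivotNorm A 0 := by
  rw [pivotNorm_of _ 0 (by omega), pivotNorm_of _ 0 hn]
  rfl

lemma pivotNorm_padM_succ {n : ℕ} (hn : 0 < n) (A : Matrix (Fin n) (Fin n) 𝕜) (k : ℕ)
    (hk : k < n) : pivotNorm (padM hn A) (k + 1) = pivotNorm A k := by
  rw [pivotNorm_of _ (k + 1) (by omega), pivotNorm_of _ k hk,
    ← geIter_padM hn A k ⟨k, hk⟩ ⟨k, hk⟩ le_rfl le_rfl]
  rfl

lemma isCP_padM {n : ℕ} (hn : 0 < n) {A : Matrix (Fin n) (Fin n) 𝕜} (hA : IsCP A) :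
    IsCP (padM hn A) := by
  refine ⟨?_, ?_, ?_⟩
  · have hd : (padM hn A).det = A ⟨0, hn⟩ ⟨0, hn⟩ * A.det := by
      rw [Matrix.det_succ_row_zero, Fin.sum_univ_succ]
      have : (padM hn A).submatrix Fin.succ Fin.succ = A := by
        ext i j; rfl
      simp [padM]
      left
      exact congrArg Matrix.det this
    rw [hd]
    exact mul_ne_zero (hA.pivot_ne 0 hn) hA.1
  · intro k hk
    cases k with
    | zero => rw [pivotNorm_padM_zero]; exact (hA.pivot_pos 0 hn).ne'
    | succ k => rw [pivotNorm_padM_succ _ _ _ (by omega)]; exact (hA.pivot_pos k (by omega)).ne'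
  · intro k i j hi hj
    cases k with
    | zero =>
      rw [pivotNorm_padM_zero]
      refine Fin.cases ?_ (fun i' => ?_) i <;> refine Fin.cases ?_ (fun j' => ?_) j
      · rw [pivotNorm_of _ 0 hn]; rfl
      · simpa [geIter, padM] using pivotNorm_nonneg A 0
      · simpa [geIter, padM] using pivotNorm_nonneg A 0
      · exact hA.2.2 0 i' j' (by simp) (by simp)
    | succ k =>
      obtain ⟨i', rfl⟩ := Fin.exists_succ_eq.mpr (show i ≠ 0 by rintro rfl; simp at hi)
      obtain ⟨j', rfl⟩ := Fin.exists_succ_eq.mpr (show j ≠ 0 by rintro rfl; simp at hj)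
      have hi' : k ≤ i'.1 := by simpa using hi
      have hj' : k ≤ j'.1 := by simpa using hj
      rw [geIter_padM hn A k i' j' hi' hj', pivotNorm_padM_succ hn A k (by omega)]
      exact hA.2.2 k i' j' hi' hj'

lemma gCP_mono (n : ℕ) (hn : 0 < n) : gCP 𝕜 n ≤ gCP 𝕜 (n + 1) := by
  have := gCP_step (𝕜 := 𝕜) 1 zero_le_one n (n + 1) (by omega) (fun A hA => ?_)
  · simpa using this
  refine ⟨padM hn A, isCP_padM hn hA, ?_⟩
  rw [one_mul]
  apply growth_le hn hA
  intro k hk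
  have := le_growth (by omega) (isCP_padM hn hA) (k + 1) (by omega)
  rwa [pivotNorm_padM_zero, pivotNorm_padM_succ _ _ _ hk] at this

/-! Doubling -/

/-- Halving of an index. -/
def hf {n : ℕ} (i : Fin (2 * n)) : Fin n := ⟨i.1 / 2, by omega⟩

/-- Sign of the Hadamard matrix of order two. -/
def sg (𝕜 : Type*) [RCLike 𝕜] (i j : ℕ) : 𝕜 := if i % 2 = 1 ∧ j % 2 = 1 then -1 else 1

/-- `A ⊗ H`. -/
def dblM {n : ℕ} (A : Matrix (Fin n) (Fin n) 𝕜) : Matrix (Fin (2 * n)) (Fin (2 * n)) 𝕜 :=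
  fun i j => A (hf i) (hf j) * sg 𝕜 i.1 j.1

lemma hf_even {n : ℕ} (k : ℕ) (hk : k < n) (h : 2 * k < 2 * n) :
    hf (⟨2 * k, h⟩ : Fin (2 * n)) = ⟨k, hk⟩ := Fin.ext (by simp [hf])

lemma hf_odd {n : ℕ} (k : ℕ) (hk : k < n) (h : 2 * k + 1 < 2 * n) :
    hf (⟨2 * k + 1, h⟩ : Fin (2 * n)) = ⟨k, hk⟩ := Fin.ext (by simp [hf]; omega)

lemma dbl_odd_of {n : ℕ} (A : Matrix (Fin n) (Fin n) 𝕜) (k : ℕ) (hk : k < n)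
    (h : ∀ i j : Fin (2 * n), 2 * k ≤ i.1 → 2 * k ≤ j.1 →
      geIter (dblM A) (2 * k) i j = geIter A k (hf i) (hf j) * sg 𝕜 i.1 j.1)
    (i j : Fin (2 * n)) (hi : 2 * k + 1 ≤ i.1) (hj : 2 * k + 1 ≤ j.1) :
    geIter (dblM A) (2 * k + 1) i j = geIter A k (hf i) (hf j) * sg 𝕜 i.1 j.1 -
      geIter A k (hf i) ⟨k, hk⟩ * geIter A k ⟨k, hk⟩ (hf j) / geIter A k ⟨k, hk⟩ ⟨k, hk⟩ := by
  rw [geIter_succ_of _ (2 * k) (by omega) i j hi hj, h i j (by omega) (by omega),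
    h i _ (by omega) le_rfl, h _ j le_rfl (by omega), h _ _ le_rfl le_rfl, hf_even k hk]
  simp [sg]

lemma dbl_even {n : ℕ} {A : Matrix (Fin n) (Fin n) 𝕜} (hA : IsCP A) (k : ℕ) :
    ∀ i j : Fin (2 * n), 2 * k ≤ i.1 → 2 * k ≤ j.1 →
      geIter (dblM A) (2 * k) i j = geIter A k (hf i) (hf j) * sg 𝕜 i.1 j.1 := by
  induction k with
  | zero => intro i j _ _; rfl
  | succ k ih =>
    intro i j hi hj
    have hk : k < n := by omega
    have e : 2 * (k + 1) = (2 * k + 1) + 1 := by ring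
    have hp := hA.pivot_ne k hk
    rw [e, geIter_succ_of _ (2 * k + 1) (by omega) i j (by omega) (by omega)]
    rw [dbl_odd_of A k hk ih i j (by omega) (by omega),
      dbl_odd_of A k hk ih i _ (by omega) le_rfl, dbl_odd_of A k hk ih _ j le_rfl (by omega),
      dbl_odd_of A k hk ih _ _ le_rfl le_rfl, hf_odd k hk,
      geIter_succ_of A k hk (hf i) (hf j) (by simp [hf]; omega) (by simp [hf]; omega)]
    generalize geIter A k ⟨k, hk⟩ ⟨k, hk⟩ = p at hp
    generalize geIter A k (hf i) ⟨k, hk⟩ = x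
    generalize geIter A k ⟨k, hk⟩ (hf j) = y
    generalize geIter A k (hf i) (hf j) = a
    have h2 : (2 : 𝕜) ≠ 0 := two_ne_zero
    have e1 : (2 * k + 1) % 2 = 1 := by omega
    have e2 : p * (-1) - p * p / p = -(2 * p) := by field_simp; ring
    have e3 : x * p / p = x := by field_simp
    have e4 : p * y / p = y := by field_simp
    simp only [sg, e1, and_true, true_and, if_true, e2, e3, e4]
    by_cases hi2 : i.1 % 2 = 1 <;> by_cases hj2 : j.1 % 2 = 1 <;>
      simp only [hi2, hj2, and_true, and_false, if_true, if_false] <;> field_simp <;> ring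

lemma dbl_odd {n : ℕ} {A : Matrix (Fin n) (Fin n) 𝕜} (hA : IsCP A) (k : ℕ) (hk : k < n)
    (i j : Fin (2 * n)) (hi : 2 * k + 1 ≤ i.1) (hj : 2 * k + 1 ≤ j.1) :
    geIter (dblM A) (2 * k + 1) i j = geIter A k (hf i) (hf j) * sg 𝕜 i.1 j.1 -
      geIter A k (hf i) ⟨k, hk⟩ * geIter A k ⟨k, hk⟩ (hf j) / geIter A k ⟨k, hk⟩ ⟨k, hk⟩ :=
  dbl_odd_of A k hk (dbl_even hA k) i j hi hj

lemma pivotNorm_dbl_even {n : ℕ} {A : Matrix (Fin n) (Fin n) 𝕜} (hA : IsCP A) (k : ℕ)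
    (hk : k < n) : pivotNorm (dblM A) (2 * k) = pivotNorm A k := by
  rw [pivotNorm_of _ (2 * k) (by omega), pivotNorm_of _ k hk, dbl_even hA k _ _ le_rfl le_rfl,
    hf_even k hk]
  simp [sg]

lemma pivotNorm_dbl_odd {n : ℕ} {A : Matrix (Fin n) (Fin n) 𝕜} (hA : IsCP A) (k : ℕ)
    (hk : k < n) : pivotNorm (dblM A) (2 * k + 1) = 2 * pivotNorm A k := by
  rw [pivotNorm_of _ (2 * k + 1) (by omega), pivotNorm_of _ k hk,
    dbl_odd hA k hk _ _ le_rfl le_rfl, hf_odd k hk]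
  have hp := hA.pivot_ne k hk
  generalize geIter A k ⟨k, hk⟩ ⟨k, hk⟩ = p at hp
  have e1 : (2 * k + 1) % 2 = 1 := by omega
  have e2 : p * (-1) - p * p / p = -(2 * p) := by field_simp; ring
  simp only [sg, e1, and_true, if_true, e2]
  rw [norm_neg, norm_mul]
  simp

lemma norm_mul_sg (a : 𝕜) (i j : ℕ) : ‖a * sg 𝕜 i j‖ = ‖a‖ := by
  unfold sg
  split_ifs <;> simp

lemma det_dblM {n : ℕ} {A : Matrix (Fin n) (Fin n) 𝕜} (hA : A.det ≠ 0) : (dblM A).det ≠ 0 := by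
  let H : Matrix (Fin 2) (Fin 2) 𝕜 := fun a b => sg 𝕜 a.1 b.1
  let e : Fin n × Fin 2 ≃ Fin (2 * n) := finProdFinEquiv.trans (finCongr (mul_comm n 2))
  have hB : (dblM A).submatrix e e = Matrix.kroneckerMap (fun a b => a * b) A H := by
    ext ⟨i, a⟩ ⟨j, b⟩
    have h1 : ∀ (i : Fin n) (a : Fin 2), hf (e (i, a)) = i := by
      intro i a
      apply Fin.ext
      simp [hf, e]
      omega
    have h2 : ∀ (i : Fin n) (a : Fin 2), (e (i, a)).1 % 2 = a.1 % 2 := by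
      intro i a
      simp [e]
    simp only [Matrix.submatrix_apply, dblM, h1, H, sg, h2]
    rfl
  have hdet := Matrix.det_submatrix_equiv_self e (dblM A)
  rw [← hdet, hB]
  have hk := Matrix.det_kronecker A H
  rw [hk]
  apply mul_ne_zero (pow_ne_zero _ hA) (pow_ne_zero _ _)
  rw [Matrix.det_fin_two]
  simp [H, sg]
  norm_num

lemma isCP_dblM {n : ℕ} {A : Matrix (Fin n) (Fin n) 𝕜} (hA : IsCP A) : IsCP (dblM A) := by
  refine ⟨det_dblM hA.1, ?_, ?_⟩
  · intro m hm
    obtain ⟨k, rfl | rfl⟩ := Nat.even_or_odd' m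
    · rw [pivotNorm_dbl_even hA k (by omega)]
      exact (hA.pivot_pos k (by omega)).ne'
    · rw [pivotNorm_dbl_odd hA k (by omega)]
      have := hA.pivot_pos k (by omega)
      positivity
  · intro m i j hi hj
    obtain ⟨k, rfl | rfl⟩ := Nat.even_or_odd' m
    · rw [pivotNorm_dbl_even hA k (by omega), dbl_even hA k i j hi hj, norm_mul_sg]
      exact hA.2.2 k _ _ (by simp [hf]; omega) (by simp [hf]; omega)
    · have hk : k < n := by omega
      rw [pivotNorm_dbl_odd hA k hk, dbl_odd hA k hk i j hi hj]
      have hp := pivotNorm_of A k hk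
      rw [hp]
      have hi' : k ≤ (hf i).1 := by simp [hf]; omega
      have hj' : k ≤ (hf j).1 := by simp [hf]; omega
      refine (norm_quot_le _ _ _ _ (hA.pivot_ne k hk) ?_ ?_ ?_).1
      · rw [norm_mul_sg, ← hp]; exact hA.2.2 k _ _ hi' hj'
      · rw [← hp]; exact hA.2.2 k _ _ hi' le_rfl
      · rw [← hp]; exact hA.2.2 k _ _ le_rfl hj'

lemma gCP_double (n : ℕ) (hn : 0 < n) : 2 * gCP 𝕜 n ≤ gCP 𝕜 (2 * n) := by
  refine gCP_step 2 zero_le_two n (2 * n) (by omega) (fun A hA => ?_)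
  refine ⟨dblM A, isCP_dblM hA, ?_⟩
  rw [← le_div_iff₀' (by norm_num)]
  apply growth_le hn hA
  intro k hk
  have h1 := le_growth (by omega) (isCP_dblM hA) (2 * k + 1) (by omega)
  have h2 := pivotNorm_dbl_even hA 0 hn
  rw [mul_zero] at h2
  rw [h2, pivotNorm_dbl_odd hA k hk] at h1
  linarith

lemma gCP_half (n : ℕ) (hn : 2 ≤ n) : 2 * gCP 𝕜 (n / 2) ≤ gCP 𝕜 n := by
  have h1 := gCP_double (𝕜 := 𝕜) (n / 2) (by omega)
  rcases Nat.mod_two_eq_zero_or_one n with h | h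
  · rwa [show 2 * (n / 2) = n by omega] at h1
  · have h2 := gCP_mono (𝕜 := 𝕜) (2 * (n / 2)) (by omega)
    rw [show 2 * (n / 2) + 1 = n by omega] at h2
    exact h1.trans h2

end Aux

lemma factor_mem (k : ℕ) (hk : 2 ≤ k) (j : ℕ) :
    0 < (1 - 1 / (k : ℝ) * (1 / 2) ^ j) ∧ (1 - 1 / (k : ℝ) * (1 / 2) ^ j) ≤ 1 := by
  have hk' : (2 : ℝ) ≤ k := by exact_mod_cast hk
  have h1 : 1 / (k : ℝ) ≤ 1 / 2 := one_div_le_one_div_of_le (by norm_num) hk'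
  have h0 : 0 < 1 / (k : ℝ) := by positivity
  have h2 : ((1 : ℝ) / 2) ^ j ≤ 1 := pow_le_one₀ (by norm_num) (by norm_num)
  have h3 : 0 < ((1 : ℝ) / 2) ^ j := by positivity
  constructor <;> nlinarith

lemma qPoch_le (k : ℕ) (hk : 2 ≤ k) (J : ℕ) :
    qPochInf (1 / k) (1 / 2) ≤ ∏ j ∈ Finset.range J, (1 - 1 / (k : ℝ) * (1 / 2) ^ j) := by
  have hm : Multipliable (fun j : ℕ => (1 - 1 / (k : ℝ) * (1 / 2) ^ j)) := by
    have hs : Summable (fun j : ℕ => -(1 / (k : ℝ) * (1 / 2) ^ j)) :=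
      (summable_geometric_two.mul_left _).neg
    simpa [sub_eq_add_neg] using Real.multipliable_one_add_of_summable hs
  have ht := hm.hasProd.tendsto_prod_nat
  have ha : Antitone (fun J : ℕ => ∏ j ∈ Finset.range J, (1 - 1 / (k : ℝ) * (1 / 2) ^ j)) := by
    apply antitone_nat_of_succ_le
    intro n
    rw [Finset.prod_range_succ]
    exact mul_le_of_le_one_right (Finset.prod_nonneg fun j _ => (factor_mem k hk j).1.le)
      (factor_mem k hk n).2
  exact ha.le_of_tendsto ht J

/-- extrapolation of linear lower bounds for `g[CP_n(𝕜)]`. -/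
theorem gCP_extrapolate {𝕜 : Type*} [RCLike 𝕜] (k : ℕ) (hk : 2 ≤ k) (C : ℝ)
    (hC : 0 < C) (h : ∀ n : ℕ, k ≤ n → n ≤ 2 * k - 1 → C * n ≤ gCP 𝕜 n) :
    ∀ n : ℕ, k ≤ n →
      qPochInf (1 / k) (1 / 2) / (1 - 1 / k) * (C * n) ≤ gCP 𝕜 n := by
  have hk' : (2 : ℝ) ≤ k := by exact_mod_cast hk
  have hpos : 0 < 1 - 1 / (k : ℝ) := by simpa using (factor_mem k hk 0).1
  have key : ∀ J n : ℕ, k * 2 ^ J ≤ n → n < k * 2 ^ (J + 1) →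
      (∏ j ∈ Finset.range (J + 1), (1 - 1 / (k : ℝ) * (1 / 2) ^ j)) / (1 - 1 / k) * (C * n)
        ≤ gCP 𝕜 n := by
    intro J
    induction J with
    | zero =>
      intro n h1 h2
      have := h n (by simpa using h1) (by simp at h2; omega)
      simpa [div_self hpos.ne', -one_div] using this
    | succ J ih =>
      intro n h1 h2
      have e1 : k * 2 ^ (J + 1) = 2 * (k * 2 ^ J) := by ring
      have e2 : k * 2 ^ (J + 1 + 1) = 2 * (k * 2 ^ (J + 1)) := by ring
      have hm := ih (n / 2) (by omega) (by omega)
      have hN : 1 ≤ 2 ^ J := Nat.one_le_two_pow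
      have hkN : 2 ≤ k * 2 ^ J := by nlinarith
      have hh := gCP_half (𝕜 := 𝕜) n (by omega)
      rw [Finset.prod_range_succ]
      set Q := ∏ j ∈ Finset.range (J + 1), (1 - 1 / (k : ℝ) * (1 / 2) ^ j) with hQ
      have hQ0 : 0 ≤ Q := Finset.prod_nonneg fun j _ => (factor_mem k hk j).1.le
      have hnm : (n : ℝ) ≤ 2 * ((n / 2 : ℕ) : ℝ) + 1 := by
        have : n ≤ 2 * (n / 2) + 1 := by omega
        exact_mod_cast this
      have h1' : (k : ℝ) * 2 ^ (J + 1) ≤ n := by exact_mod_cast h1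
      have hkey : (1 - 1 / (k : ℝ) * (1 / 2) ^ (J + 1)) * n ≤ 2 * ((n / 2 : ℕ) : ℝ) := by
        have : 1 ≤ 1 / (k : ℝ) * (1 / 2) ^ (J + 1) * n := by
          rw [one_div_pow, div_mul_div_comm, one_mul, div_mul_eq_mul_div, one_mul,
            le_div_iff₀ (by positivity), one_mul]
          exact h1'
        linarith
      have hD : 0 ≤ Q / (1 - 1 / k) * C := mul_nonneg (div_nonneg hQ0 hpos.le) hC.le
      have hfin := mul_le_mul_of_nonneg_left hkey hD
      calc _ = Q / (1 - 1 / k) * C * ((1 - 1 / (k : ℝ) * (1 / 2) ^ (J + 1)) * n) := by ring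
        _ ≤ Q / (1 - 1 / k) * C * (2 * ((n / 2 : ℕ) : ℝ)) := hfin
        _ = 2 * (Q / (1 - 1 / k) * (C * ((n / 2 : ℕ) : ℝ))) := by ring
        _ ≤ 2 * gCP 𝕜 (n / 2) := by linarith
        _ ≤ gCP 𝕜 n := hh
  intro n hn
  have hq : n / k ≠ 0 := (Nat.div_pos hn (by omega)).ne'
  have b1 : k * 2 ^ (Nat.log 2 (n / k)) ≤ n :=
    (Nat.mul_le_mul_left k (Nat.pow_log_le_self 2 hq)).trans (Nat.mul_div_le n k)
  have b2 : n < k * 2 ^ (Nat.log 2 (n / k) + 1) := by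
    have := Nat.lt_pow_succ_log_self (b := 2) (by norm_num) (n / k)
    rw [mul_comm]
    exact (Nat.div_lt_iff_lt_mul (by omega)).mp this
  refine le_trans ?_ (key _ n b1 b2)
  have hn0 : 0 ≤ C * (n : ℝ) := by positivity
  exact mul_le_mul_of_nonneg_right (div_le_div_of_nonneg_right (qPoch_le k hk _) hpos.le) hn0
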